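/- Let α ≥ 0 be an admissible exponent of A with associated sequence (M_n), and suppose there exists θ > 0 with ‖u‖_α ≤ θ‖G_α u‖_α for all u ∈ c00(α). If n ∈ ℕ and x₀ ∈ E satisfy sup_{m≥n} ‖A(m,n)x₀‖ < ∞, then for every k ∈ ℕ and every integer m > n, ‖A(m,n)x₀‖ ≤ (k! θ^k/(m−n)^k) · Ñ_n · ‖x₀‖, where Ñ_n = θ e^{αθ} M_n. -/

import Mathlib

open Filter Topology

variable {E : Type*} [NormedAddCommGroup E] [NormedSpace ℝ E] [CompleteSpace E]

/-- `evol A n m` is the evolution operator `A(m,n) = A_{m-1} ∘ ⋯ ∘ A_n`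
(the identity if `m ≤ n`). -/
def evol (A : ℕ → E →L[ℝ] E) (n : ℕ) : ℕ → E →L[ℝ] E
  | 0 => 1
  | m + 1 => if n ≤ m then A m * evol A n m else 1

/-- `α` is an admissible exponent for `A`: there is a positive sequence `M` with
`‖A(m,n)‖ ≤ M n * e^{α (m - n)}` for all `m ≥ n`. -/
def IsAdmissible (A : ℕ → E →L[ℝ] E) (α : ℝ) : Prop :=
  ∃ M : ℕ → ℝ, (∀ n, 0 < M n) ∧
    ∀ m n : ℕ, n ≤ m → ‖evol A n m‖ ≤ M n * Real.exp (α * ((m : ℝ) - (n : ℝ)))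

/-- The norm `‖x‖_{n,α} = sup_{m ≥ n} e^{-α(m-n)} ‖A(m,n) x‖`. -/
noncomputable def nnorm (A : ℕ → E →L[ℝ] E) (α : ℝ) (n : ℕ) (x : E) : ℝ :=
  ⨆ m : Set.Ici n, Real.exp (-α * (((m : ℕ) : ℝ) - (n : ℝ))) * ‖evol A n (m : ℕ) x‖

/-- Membership in `c00(α)`: `u 0 = 0` and `‖u n‖_{n,α} → 0`. -/
def MemC00 (A : ℕ → E →L[ℝ] E) (α : ℝ) (u : ℕ → E) : Prop :=
  u 0 = 0 ∧ Tendsto (fun n => nnorm A α n (u n)) atTop (𝓝 0)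

/-- The norm `‖u‖_α = sup_n ‖u n‖_{n,α}` on `c00(α)`. -/
noncomputable def cnorm (A : ℕ → E →L[ℝ] E) (α : ℝ) (u : ℕ → E) : ℝ :=
  ⨆ n, nnorm A α n (u n)

/-- The evolution map `T`: `(Tu)_0 = 0`, `(Tu)_{n+1} = A_n u_n`. -/
def Tmap (A : ℕ → E →L[ℝ] E) (u : ℕ → E) : ℕ → E
  | 0 => 0
  | m + 1 => A m (u m)

/-- `G = T - Id`. -/
def Gmap (A : ℕ → E →L[ℝ] E) (u : ℕ → E) : ℕ → E :=
  fun n => Tmap A u n - u n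

section EvolutionFamily

variable {F : Type*} [NormedAddCommGroup F] [NormedSpace ℝ F]

lemma evol_self (A : ℕ → F →L[ℝ] F) (n : ℕ) : evol A n n = 1 := by
  cases n <;> simp [evol]

lemma evol_succ (A : ℕ → F →L[ℝ] F) {n m : ℕ} (h : n ≤ m) (x : F) :
    evol A n (m + 1) x = A m (evol A n m x) := by
  simp [evol, h]

lemma evol_evol (A : ℕ → F →L[ℝ] F) {n m p : ℕ} (hnm : n ≤ m) (hmp : m ≤ p) (x : F) :
    evol A m p (evol A n m x) = evol A n p x := by
  induction p, hmp using Nat.le_induction with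
  | base => simp [evol_self]
  | succ p hp ih => rw [evol_succ A hp, ih, evol_succ A (hnm.trans hp)]

/-- A sequence `M` witnessing that `α` is an admissible exponent of `A`. -/
def IsGrowthBound (A : ℕ → F →L[ℝ] F) (α : ℝ) (M : ℕ → ℝ) : Prop :=
  ∀ m n : ℕ, n ≤ m → ‖evol A n m‖ ≤ M n * Real.exp (α * ((m : ℝ) - (n : ℝ)))

variable {A : ℕ → F →L[ℝ] F} {α : ℝ} {M : ℕ → ℝ}

lemma IsGrowthBound.exp_mul_norm_evol_le (hbd : IsGrowthBound A α M) {n m : ℕ} (h : n ≤ m)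
    (x : F) :
    Real.exp (-α * ((m : ℝ) - (n : ℝ))) * ‖evol A n m x‖ ≤ M n * ‖x‖ := by
  calc Real.exp (-α * ((m : ℝ) - (n : ℝ))) * ‖evol A n m x‖
      ≤ Real.exp (-α * ((m : ℝ) - (n : ℝ))) *
          (M n * Real.exp (α * ((m : ℝ) - (n : ℝ))) * ‖x‖) := by
        gcongr
        exact (evol A n m).le_of_opNorm_le (hbd m n h) x
    _ = Real.exp (-α * ((m : ℝ) - (n : ℝ)) + α * ((m : ℝ) - (n : ℝ))) * (M n * ‖x‖) := by
        rw [Real.exp_add]; ring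
    _ = M n * ‖x‖ := by simp

lemma IsGrowthBound.exp_mul_norm_evol_le_nnorm (hbd : IsGrowthBound A α M) {n m : ℕ} (h : n ≤ m)
    (x : F) :
    Real.exp (-α * ((m : ℝ) - (n : ℝ))) * ‖evol A n m x‖ ≤ nnorm A α n x := by
  refine le_ciSup (f := fun m : Set.Ici n =>
    Real.exp (-α * (((m : ℕ) : ℝ) - (n : ℝ))) * ‖evol A n (m : ℕ) x‖) ?_ ⟨m, h⟩
  refine ⟨M n * ‖x‖, ?_⟩
  rintro _ ⟨p, rfl⟩
  exact hbd.exp_mul_norm_evol_le p.2 x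

lemma nnorm_le {n : ℕ} {x : F} {c : ℝ}
    (h : ∀ m, n ≤ m → Real.exp (-α * ((m : ℝ) - (n : ℝ))) * ‖evol A n m x‖ ≤ c) :
    nnorm A α n x ≤ c :=
  ciSup_le fun m => h m m.2

lemma nnorm_nonneg (A : ℕ → F →L[ℝ] F) (α : ℝ) (n : ℕ) (x : F) : 0 ≤ nnorm A α n x :=
  Real.iSup_nonneg fun _ => by positivity

lemma IsGrowthBound.norm_le_nnorm (hbd : IsGrowthBound A α M) (n : ℕ) (x : F) :
    ‖x‖ ≤ nnorm A α n x := by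
  simpa [evol_self] using hbd.exp_mul_norm_evol_le_nnorm le_rfl x

lemma IsGrowthBound.nnorm_le (hbd : IsGrowthBound A α M) (n : ℕ) (x : F) :
    nnorm A α n x ≤ M n * ‖x‖ :=
  _root_.nnorm_le fun _ h => hbd.exp_mul_norm_evol_le h x

lemma nnorm_smul (A : ℕ → F →L[ℝ] F) (α : ℝ) (n : ℕ) (c : ℝ) (x : F) :
    nnorm A α n (c • x) = |c| * nnorm A α n x := by
  unfold nnorm
  rw [Real.mul_iSup_of_nonneg (abs_nonneg c)]
  congr 1
  ext m
  rw [map_smul, norm_smul, Real.norm_eq_abs]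
  ring

lemma nnorm_zero (A : ℕ → F →L[ℝ] F) (α : ℝ) (n : ℕ) : nnorm A α n (0 : F) = 0 := by
  simpa using nnorm_smul A α n 0 (0 : F)

lemma IsGrowthBound.nnorm_succ_le (hbd : IsGrowthBound A α M) (n : ℕ) (x : F) :
    nnorm A α (n + 1) (evol A n (n + 1) x) ≤ Real.exp α * nnorm A α n x := by
  refine _root_.nnorm_le fun m hm => ?_
  rw [evol_evol A n.le_succ hm]
  have h := hbd.exp_mul_norm_evol_le_nnorm (n.le_succ.trans hm) x
  calc Real.exp (-α * ((m : ℝ) - ((n + 1 : ℕ) : ℝ))) * ‖evol A n m x‖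
      = Real.exp α * (Real.exp (-α * ((m : ℝ) - (n : ℝ))) * ‖evol A n m x‖) := by
        rw [← mul_assoc, ← Real.exp_add]
        congr 2
        push_cast
        ring
    _ ≤ _ := by gcongr

lemma nnorm_evol_le (hα : 0 ≤ α) {n : ℕ} {x : F} {K : ℝ}
    (hK : ∀ m, n ≤ m → ‖evol A n m x‖ ≤ K) {m : ℕ} (hm : n ≤ m) :
    nnorm A α m (evol A n m x) ≤ K := by
  refine nnorm_le fun p hp => ?_
  rw [evol_evol A hm hp]
  refine le_trans (mul_le_of_le_one_left (norm_nonneg _) ?_) (hK p (hm.trans hp))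
  have : (m : ℝ) ≤ p := by exact_mod_cast hp
  exact Real.exp_le_one_iff.2 (by nlinarith)

/-- The lower bound for `G` tested on a finitely supported rescaling of an orbit. -/
lemma weighted_nnorm_evol_le {θ : ℝ} (hθ : 0 ≤ θ)
    (hbelow : ∀ u, MemC00 A α u → cnorm A α u ≤ θ * cnorm A α (Gmap A u))
    (n : ℕ) (x : F) (φ : ℕ → ℝ) (hφ0 : φ 0 = 0) (hφ : ∀ᶠ i in atTop, φ i = 0)
    {B : ℝ} (hB0 : 0 ≤ B)
    (hB : ∀ i, |φ i - φ (i + 1)| * nnorm A α (n + (i + 1)) (evol A n (n + (i + 1)) x) ≤ B)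
    (i : ℕ) :
    |φ i| * nnorm A α (n + i) (evol A n (n + i) x) ≤ θ * B := by
  set u : ℕ → F := fun j => φ (j - n) • evol A n j x with hu
  have hlim : Tendsto (fun j => nnorm A α j (u j)) atTop (𝓝 0) := by
    refine tendsto_const_nhds.congr' ?_
    filter_upwards [(tendsto_sub_atTop_nat n).eventually hφ] with j hj
    simp [hu, hj, nnorm_zero]
  have hmem : MemC00 A α u := ⟨by simp [hu, hφ0], hlim⟩
  have hle : nnorm A α (n + i) (u (n + i)) ≤ cnorm A α u :=
    le_ciSup (f := fun j => nnorm A α j (u j)) hlim.bddAbove_range (n + i)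
  have hG : cnorm A α (Gmap A u) ≤ B := by
    refine ciSup_le fun j => ?_
    rcases le_or_gt j n with hj | hj
    · have hGj : Gmap A u j = 0 := by
        cases j with
        | zero => simp [Gmap, Tmap, hu, hφ0]
        | succ j =>
          have h1 : j - n = 0 := by omega
          have h2 : j + 1 - n = 0 := by omega
          simp [Gmap, Tmap, hu, h1, h2, hφ0]
      rw [hGj, nnorm_zero]
      exact hB0
    · obtain ⟨l, rfl⟩ := Nat.exists_eq_add_of_lt hj
      have hGj : Gmap A u (n + (l + 1)) = (φ l - φ (l + 1)) • evol A n (n + (l + 1)) x := by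
        have hT : Tmap A u (n + (l + 1)) = A (n + l) (u (n + l)) := rfl
        simp only [Gmap, hT]
        simp only [hu, map_smul, Nat.add_sub_cancel_left, sub_smul]
        rw [← evol_succ A (Nat.le_add_right n l), add_assoc]
      rw [add_assoc, hGj, nnorm_smul]
      exact hB l
  calc |φ i| * nnorm A α (n + i) (evol A n (n + i) x)
      = nnorm A α (n + i) (u (n + i)) := by simp [hu, nnorm_smul]
    _ ≤ cnorm A α u := hle
    _ ≤ θ * cnorm A α (Gmap A u) := hbelow u hmem
    _ ≤ θ * B := by gcongr

/-- The lower bound for `G` tested on an orbit rescaled by an arbitrary weight, which is cut off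
linearly beyond a given index. -/
lemma weight_mul_nnorm_evol_le {θ : ℝ} (hθ : 0 ≤ θ)
    (hbelow : ∀ u, MemC00 A α u → cnorm A α u ≤ θ * cnorm A α (Gmap A u))
    (n : ℕ) (x : F) (g : ℕ → ℝ) (hg0 : g 0 = 0) (hg : ∀ i, 0 ≤ g i) {ε B : ℝ} (hε : 0 < ε)
    (hgB : ∀ i, |g i - g (i + 1)| * nnorm A α (n + (i + 1)) (evol A n (n + (i + 1)) x) ≤ B)
    (hεB : ∀ i, ε * nnorm A α (n + (i + 1)) (evol A n (n + (i + 1)) x) ≤ B) (N : ℕ) :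
    g N * nnorm A α (n + N) (evol A n (n + N) x) ≤ θ * B := by
  set φ : ℕ → ℝ := fun j => max 0 (min (g j) (g N - ε * ((j : ℝ) - N))) with hφ
  have hφN : φ N = g N := by simp [hφ, hg N]
  have hφ0 : φ 0 = 0 := by simp [hφ, hg0]
  have hφlim : ∀ᶠ j in atTop, φ j = 0 := by
    obtain ⟨L, hL⟩ := exists_nat_ge (g N / ε + N)
    filter_upwards [eventually_ge_atTop L] with j hj
    have hjL : (L : ℝ) ≤ j := by exact_mod_cast hj
    have h : g N / ε ≤ (j : ℝ) - N := by linarith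
    rw [div_le_iff₀ hε] at h
    exact max_eq_left ((min_le_right _ _).trans (by linarith))
  have hB0 : 0 ≤ B := (mul_nonneg hε.le (nnorm_nonneg _ _ _ _)).trans (hεB 0)
  have hstep : ∀ j, |φ j - φ (j + 1)| ≤ max |g j - g (j + 1)| ε := by
    intro j
    have h1 : |φ j - φ (j + 1)| ≤ |min (g j) (g N - ε * ((j : ℝ) - N)) -
        min (g (j + 1)) (g N - ε * (((j + 1 : ℕ) : ℝ) - N))| := by
      simp only [hφ, max_comm (0 : ℝ)]
      exact abs_max_sub_max_le_abs _ _ _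
    refine h1.trans ((abs_min_sub_min_le_max _ _ _ _).trans (max_le_max le_rfl ?_))
    push_cast
    rw [show g N - ε * ((j : ℝ) - N) - (g N - ε * ((j : ℝ) + 1 - N)) = ε by ring,
      abs_of_pos hε]
  have := weighted_nnorm_evol_le hθ hbelow n x φ hφ0 hφlim hB0 (fun j => ?_) N
  · rwa [hφN, abs_of_nonneg (hg N)] at this
  · refine (mul_le_mul_of_nonneg_right (hstep j) (nnorm_nonneg _ _ _ _)).trans ?_
    rw [max_mul_of_nonneg _ _ (nnorm_nonneg _ _ _ _)]
    exact max_le (hgB j) (hεB j)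

/-- The lower bound for `G` makes bounded orbits uniformly bounded by their first term. -/
lemma nnorm_evol_le_of_bounded {θ : ℝ} (hθ : 0 ≤ θ) (hα : 0 ≤ α) (hbd : IsGrowthBound A α M)
    (hbelow : ∀ u, MemC00 A α u → cnorm A α u ≤ θ * cnorm A α (Gmap A u))
    {n : ℕ} {x : F} {K : ℝ} (hK : ∀ m, n ≤ m → ‖evol A n m x‖ ≤ K) (i : ℕ) :
    nnorm A α (n + (i + 1)) (evol A n (n + (i + 1)) x) ≤
      θ * Real.exp (α * θ) * nnorm A α n x := by
  set a : ℕ → ℝ := fun i => nnorm A α (n + i) (evol A n (n + i) x) with ha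
  have hx := nnorm_nonneg A α n x
  change a (i + 1) ≤ _
  have ha0 : ∀ i, 0 ≤ a i := fun i => nnorm_nonneg _ _ _ _
  have haK : ∀ i, a i ≤ K := fun i => nnorm_evol_le hα hK (Nat.le_add_right n i)
  rcases (ha0 1).eq_or_lt with h1 | h1
  · have hz : evol A n (n + 1) x = 0 := by
      have := hbd.norm_le_nnorm (n + 1) (evol A n (n + 1) x)
      exact norm_le_zero_iff.1 (this.trans h1.symm.le)
    have : a (i + 1) = 0 := by
      simp only [ha]
      rw [← evol_evol A n.le_succ (show n + 1 ≤ n + (i + 1) by omega), hz, map_zero, nnorm_zero]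
    rw [this]
    positivity
  have hK0 : 0 < K := h1.trans_le (haK 1)
  set ε : ℝ := a 1 / K with hε
  have hε0 : 0 < ε := div_pos h1 hK0
  have key : ∀ i, a (i + 1) ≤ θ * a 1 := by
    intro i
    have := weight_mul_nnorm_evol_le hθ hbelow n x (fun j => if j = 0 then 0 else 1) rfl
      (fun j => by split_ifs <;> simp) (B := a 1) hε0 (fun j => ?_) (fun j => ?_) (i + 1)
    · simpa using this
    · cases j <;> simp [ha, nnorm_nonneg]
    · calc ε * a (j + 1) ≤ ε * K := by gcongr; exact haK _
        _ = a 1 := div_mul_cancel₀ _ hK0.ne'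
  have hθ1 : 1 ≤ θ := by
    have := key 0
    simp only [zero_add] at this
    nlinarith
  calc a (i + 1) ≤ θ * a 1 := key i
    _ ≤ θ * (Real.exp α * nnorm A α n x) := by
        gcongr
        exact hbd.nnorm_succ_le n x
    _ ≤ θ * (Real.exp (α * θ) * nnorm A α n x) := by
        gcongr
        nlinarith
    _ = _ := by ring

/-- The lower bound for `G` makes bounded orbits decay faster than any power. -/
lemma pow_mul_nnorm_evol_le {θ : ℝ} (hθ : 0 ≤ θ)
    (hbelow : ∀ u, MemC00 A α u → cnorm A α u ≤ θ * cnorm A α (Gmap A u))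
    {n : ℕ} {x : F} {C : ℝ}
    (hC : ∀ i, nnorm A α (n + (i + 1)) (evol A n (n + (i + 1)) x) ≤ C) (k i : ℕ) :
    ((i + 1 : ℕ) : ℝ) ^ k * nnorm A α (n + (i + 1)) (evol A n (n + (i + 1)) x) ≤
      (k.factorial : ℝ) * θ ^ k * C := by
  induction k generalizing i with
  | zero => simpa using hC i
  | succ k ih =>
    have hmain : ∀ j, ((k + 1 : ℕ) : ℝ) * ((j + 1 : ℕ) : ℝ) ^ k *
        nnorm A α (n + (j + 1)) (evol A n (n + (j + 1)) x) ≤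
        ((k + 1 : ℕ) : ℝ) * ((k.factorial : ℝ) * θ ^ k * C) := by
      intro j
      rw [mul_assoc]
      exact mul_le_mul_of_nonneg_left (ih j) (Nat.cast_nonneg _)
    have := weight_mul_nnorm_evol_le hθ hbelow n x (fun j => (j : ℝ) ^ (k + 1)) (by simp)
      (fun j => by positivity) one_pos
      (fun j => (mul_le_mul_of_nonneg_right ?_ (nnorm_nonneg _ _ _ _)).trans (hmain j))
      (fun j => (mul_le_mul_of_nonneg_right ?_ (nnorm_nonneg _ _ _ _)).trans (hmain j)) (i + 1)
    · refine this.trans_eq ?_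
      rw [Nat.factorial_succ]
      push_cast
      ring
    · have h := abs_pow_sub_pow_le (j : ℝ) ((j + 1 : ℕ) : ℝ) (k + 1)
      have hj : max |(j : ℝ)| |((j + 1 : ℕ) : ℝ)| = ((j + 1 : ℕ) : ℝ) := by
        rw [Nat.abs_cast, Nat.abs_cast]
        exact max_eq_right (by simp)
      have hd : |(j : ℝ) - ((j + 1 : ℕ) : ℝ)| = 1 := by simp
      rwa [hj, hd, one_mul, Nat.add_sub_cancel] at h
    · refine one_le_mul_of_one_le_of_one_le ?_ (one_le_pow₀ ?_) <;> simp

end EvolutionFamily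

/-- Under the lower bound `‖u‖_α ≤ θ ‖G_α u‖_α` on `c00(α)` with `α ≥ 0`
admissible with sequence `(M_n)`, every bounded orbit satisfies, for every `k` and
`m > n`, `‖A(m,n) x₀‖ ≤ (k! θ^k/(m-n)^k) Ñ_n ‖x₀‖` with `Ñ_n = θ e^{αθ} M_n`. -/
theorem stmt12 (A : ℕ → E →L[ℝ] E) (α : ℝ) (hα0 : 0 ≤ α) (M : ℕ → ℝ)
    (hM : ∀ n, 0 < M n)
    (hbd : ∀ m n : ℕ, n ≤ m → ‖evol A n m‖ ≤ M n * Real.exp (α * ((m : ℝ) - (n : ℝ))))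
    (θ : ℝ) (hθ : 0 < θ)
    (hbelow : ∀ u, MemC00 A α u → cnorm A α u ≤ θ * cnorm A α (Gmap A u))
    (n : ℕ) (x₀ : E)
    (hbdd : BddAbove (Set.range fun m : Set.Ici n => ‖evol A n (m : ℕ) x₀‖)) :
    ∀ (k : ℕ) (m : ℕ), n < m →
      ‖evol A n m x₀‖ ≤
        (Nat.factorial k : ℝ) * θ ^ k / ((m : ℝ) - (n : ℝ)) ^ k *
          (θ * Real.exp (α * θ) * M n) * ‖x₀‖ := by
  intro k m hm
  obtain ⟨i, rfl⟩ := Nat.exists_eq_add_of_lt hm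
  obtain ⟨K, hK⟩ := hbdd
  have hgrowth : IsGrowthBound A α M := hbd
  have hK' : ∀ m, n ≤ m → ‖evol A n m x₀‖ ≤ K := fun m hm => hK ⟨⟨m, hm⟩, rfl⟩
  have h := pow_mul_nnorm_evol_le hθ.le hbelow
    (nnorm_evol_le_of_bounded hθ.le hα0 hgrowth hbelow hK') k i
  have hcast : ((n + i + 1 : ℕ) : ℝ) - n = ((i + 1 : ℕ) : ℝ) := by
    push_cast
    ring
  have hpos : 0 < ((i + 1 : ℕ) : ℝ) ^ k := by positivity
  rw [hcast, div_mul_eq_mul_div, div_mul_eq_mul_div, le_div_iff₀ hpos, mul_comm]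
  calc ((i + 1 : ℕ) : ℝ) ^ k * ‖evol A n (n + i + 1) x₀‖
      ≤ ((i + 1 : ℕ) : ℝ) ^ k * nnorm A α (n + (i + 1)) (evol A n (n + (i + 1)) x₀) := by
        gcongr
        exact hgrowth.norm_le_nnorm (n + (i + 1)) _
    _ ≤ (k.factorial : ℝ) * θ ^ k * (θ * Real.exp (α * θ) * nnorm A α n x₀) := h
    _ ≤ (k.factorial : ℝ) * θ ^ k * (θ * Real.exp (α * θ) * (M n * ‖x₀‖)) := by
        gcongr
        exact hgrowth.nnorm_le n x₀
    _ = _ := by ring
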